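/- arXiv:2203.07513 — 3 statements merged into one kernel-verified Lean document; each statement's English description precedes it below -/
import Mathlib

section
/- Consider a k-stage screening process with minimally effective tests. Define the stagewise Opportunity Ratio policy π by: for each stage i, let X*_i ∈ 𝒳 minimize τ^i_{X1}, and set π_X^i = (τ^i_{X*_i 1}/τ^i_{X1}, 0). Then π satisfies Equal Opportunity at every stage (for each i, M(τ_X^i, π_X^i) = τ^i_{X*_i 1} for every X ∈ 𝒳), and precision(π) = ‖q‖₁ / (‖q‖₁ + Σ_{X∈𝒳} u_X · ∏_{i=1}^k (τ^i_{X0}/τ^i_{X1})). In particular, requiring Equal Opportunity at the end of each stage does not decrease the maximum achievable precision compared to requiring it only at the final stage. -/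
open Finset

/-- Promotion probability of a positive example: `M(τ,π) = τ₁π₁ + (1−τ₁)π₀`. -/
noncomputable def Mval (t p : ℝ × ℝ) : ℝ := t.1 * p.1 + (1 - t.1) * p.2

/-- Promotion probability of a negative example: `N(τ,π) = τ₀π₁ + (1−τ₀)π₀`. -/
noncomputable def Nval (t p : ℝ × ℝ) : ℝ := t.2 * p.1 + (1 - t.2) * p.2

/-- True positive rate of group `x` through a `k`-stage pipeline. -/
noncomputable def MX {𝒳 : Type*} {k : ℕ} (τ π : 𝒳 → Fin k → ℝ × ℝ) (x : 𝒳) : ℝ :=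
  ∏ i, Mval (τ x i) (π x i)

/-- False positive rate of group `x` through a `k`-stage pipeline. -/
noncomputable def NX {𝒳 : Type*} {k : ℕ} (τ π : 𝒳 → Fin k → ℝ × ℝ) (x : 𝒳) : ℝ :=
  ∏ i, Nval (τ x i) (π x i)

/-- Precision (interview efficiency) of a policy. -/
noncomputable def prec {𝒳 : Type*} [Fintype 𝒳] {k : ℕ} (q u : 𝒳 → ℝ)
    (τ π : 𝒳 → Fin k → ℝ × ℝ) : ℝ :=
  (∑ x, q x * MX τ π x) / ((∑ x, q x * MX τ π x) + ∑ x, u x * NX τ π x)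

/-- A policy has all its entries in `[0,1]`. -/
def IsPolicy {𝒳 : Type*} {k : ℕ} (π : 𝒳 → Fin k → ℝ × ℝ) : Prop :=
  ∀ x i, (π x i).1 ∈ Set.Icc (0:ℝ) 1 ∧ (π x i).2 ∈ Set.Icc (0:ℝ) 1

/-- All tests are minimally effective: `τ₁ > τ₀ ≥ 0` (and lie in `[0,1]²`). -/
def MinEff {𝒳 : Type*} {k : ℕ} (τ : 𝒳 → Fin k → ℝ × ℝ) : Prop :=
  ∀ x i, (τ x i).2 < (τ x i).1 ∧ 0 ≤ (τ x i).2 ∧ (τ x i).1 ≤ 1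

/-- The ratio of promotion probabilities is at least the ratio `τ₀/τ₁` of an effective test. -/
lemma ratio_mul_Mval_le_Nval {t p : ℝ × ℝ} (ht : t.2 < t.1) (h0 : 0 ≤ t.2) (hp : 0 ≤ p.2) :
    t.2 / t.1 * Mval t p ≤ Nval t p := by
  have h1 : 0 < t.1 := h0.trans_lt ht
  rw [div_mul_eq_mul_div, div_le_iff₀ h1]
  unfold Mval Nval
  nlinarith [mul_nonneg (sub_nonneg.2 ht.le) hp]

lemma Mval_nonneg {t p : ℝ × ℝ} (ht : 0 ≤ t.1) (ht' : t.1 ≤ 1) (hp : 0 ≤ p.1) (hp' : 0 ≤ p.2) :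
    0 ≤ Mval t p :=
  add_nonneg (mul_nonneg ht hp) (mul_nonneg (sub_nonneg.2 ht') hp')

lemma prod_ratio_mul_MX_le_NX {𝒳 : Type*} {k : ℕ} {τ π : 𝒳 → Fin k → ℝ × ℝ}
    (hτ : MinEff τ) (hπ : IsPolicy π) (x : 𝒳) :
    (∏ i, (τ x i).2 / (τ x i).1) * MX τ π x ≤ NX τ π x := by
  unfold MX NX
  rw [← Finset.prod_mul_distrib]
  refine Finset.prod_le_prod (fun i _ => ?_) fun i _ => ?_
  all_goals
    obtain ⟨h, h0, h1⟩ := hτ x i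
    obtain ⟨hp, hp'⟩ := hπ x i
  · exact mul_nonneg (div_nonneg h0 (h0.trans h.le))
      (Mval_nonneg (h0.trans h.le) h1 hp.1 hp'.1)
  · exact ratio_mul_Mval_le_Nval h h0 hp'.1

/-- The stagewise Opportunity Ratio policy satisfies Equal Opportunity at every stage, and its
precision equals `‖q‖₁/(‖q‖₁ + Σ_X u_X ∏_i (τ^i_{X0}/τ^i_{X1}))`, the maximum precision among
policies satisfying Equal Opportunity only at the final stage. -/
theorem stmt5 {𝒳 : Type*} [Fintype 𝒳] [Nonempty 𝒳] {k : ℕ}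
    (q u : 𝒳 → ℝ) (τ : 𝒳 → Fin k → ℝ × ℝ)
    (hq : ∀ x, 0 < q x) (hu : ∀ x, 0 < u x) (hτ : MinEff τ)
    (Xstar : Fin k → 𝒳) (hXstar : ∀ i x, (τ (Xstar i) i).1 ≤ (τ x i).1)
    (π : 𝒳 → Fin k → ℝ × ℝ)
    (hπ : π = fun x i => ((τ (Xstar i) i).1 / (τ x i).1, (0:ℝ))) :
    (∀ i x, Mval (τ x i) (π x i) = (τ (Xstar i) i).1) ∧
    (prec q u τ π =
      (∑ x, q x) / ((∑ x, q x) + ∑ x, u x * ∏ i, (τ x i).2 / (τ x i).1)) ∧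
    ∀ (π' : 𝒳 → Fin k → ℝ × ℝ) (M : ℝ), IsPolicy π' → (∀ x, MX τ π' x = M) →
      0 < (∑ x, q x * MX τ π' x) + ∑ x, u x * NX τ π' x →
      prec q u τ π' ≤ prec q u τ π := by
  have hpos : ∀ x i, 0 < (τ x i).1 := fun x i => (hτ x i).2.1.trans_lt (hτ x i).1
  have hM : ∀ i x, Mval (τ x i) (π x i) = (τ (Xstar i) i).1 := fun i x => by
    simp only [hπ, Mval]
    field_simp [(hpos x i).ne']
    ring
  have hN : ∀ i x, Nval (τ x i) (π x i) = (τ x i).2 / (τ x i).1 * (τ (Xstar i) i).1 :=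
    fun i x => by
      simp only [hπ, Nval]
      ring
  have hQ : 0 < ∑ x, q x := Finset.sum_pos (fun x _ => hq x) Finset.univ_nonempty
  have hS : 0 ≤ ∑ x, u x * ∏ i, (τ x i).2 / (τ x i).1 :=
    Finset.sum_nonneg fun x _ => mul_nonneg (hu x).le <|
      Finset.prod_nonneg fun i _ => div_nonneg (hτ x i).2.1 (hpos x i).le
  have hprec : prec q u τ π =
      (∑ x, q x) / ((∑ x, q x) + ∑ x, u x * ∏ i, (τ x i).2 / (τ x i).1) := by
    have hC : (∏ i, (τ (Xstar i) i).1) ≠ 0 :=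
      Finset.prod_ne_zero_iff.2 fun i _ => (hpos _ i).ne'
    simp only [prec, MX, NX, hM, hN, Finset.prod_mul_distrib, ← mul_assoc, ← Finset.sum_mul,
      ← add_mul]
    exact mul_div_mul_right _ _ hC
  refine ⟨hM, hprec, fun π' M hπ' hEO hden => ?_⟩
  have hle : (∑ x, u x * ∏ i, (τ x i).2 / (τ x i).1) * M ≤ ∑ x, u x * NX τ π' x := by
    rw [Finset.sum_mul]
    refine Finset.sum_le_sum fun x _ => ?_
    rw [mul_assoc, ← hEO x]
    exact mul_le_mul_of_nonneg_left (prod_ratio_mul_MX_le_NX hτ hπ' x) (hu x).le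
  rw [hprec, prec, div_le_div_iff₀ hden (add_pos_of_pos_of_nonneg hQ hS)]
  simp only [hEO, ← Finset.sum_mul]
  nlinarith [mul_le_mul_of_nonneg_left hle hQ.le]
end

section
/- Consider a single-stage screening process with two groups A and B, weights q_A, q_B > 0 and u_A, u_B > 0, and minimally effective tests τ_A = (τ_{A1}, τ_{A0}) and τ_B = (τ_{B1}, τ_{B0}). Let (π_A, π_B) be any policy satisfying Equalized Odds, i.e., M(τ_A,π_A) = M(τ_B,π_B) and N(τ_A,π_A) = N(τ_B,π_B), and suppose the precision denominator is positive. Then its precision is at most (q_A + q_B) / ((q_A + q_B) + (u_A + u_B)·max(τ_{A0}/τ_{A1}, τ_{B0}/τ_{B1})). -/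
/-- The ratio of a test's error rate to its detection rate bounds `Nval` below in terms of
`Mval`. -/
theorem div_mul_Mval_le_Nval {t p : ℝ × ℝ} (ht : t.2 ≤ t.1) (ht1 : 0 < t.1) (hp : 0 ≤ p.2) :
    t.2 / t.1 * Mval t p ≤ Nval t p := by
  rw [div_mul_eq_mul_div, div_le_iff₀ ht1]
  unfold Mval Nval
  linarith [mul_nonneg (sub_nonneg.2 ht) hp]

/-- The precision of any policy satisfying Equalized Odds for a single-stage two-group
screening process is at most
`(q_A + q_B) / ((q_A + q_B) + (u_A + u_B)·max(τ_{A0}/τ_{A1}, τ_{B0}/τ_{B1}))`. -/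
theorem stmt12 (qA qB uA uB : ℝ) (τA τB πA πB : ℝ × ℝ)
    (hqA : 0 < qA) (hqB : 0 < qB) (huA : 0 < uA) (huB : 0 < uB)
    (hτA : τA.2 < τA.1 ∧ 0 ≤ τA.2 ∧ τA.1 ≤ 1)
    (hτB : τB.2 < τB.1 ∧ 0 ≤ τB.2 ∧ τB.1 ≤ 1)
    (hπA : πA.1 ∈ Set.Icc (0:ℝ) 1 ∧ πA.2 ∈ Set.Icc (0:ℝ) 1)
    (hπB : πB.1 ∈ Set.Icc (0:ℝ) 1 ∧ πB.2 ∈ Set.Icc (0:ℝ) 1)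
    (hM : Mval τA πA = Mval τB πB) (hN : Nval τA πA = Nval τB πB)
    (hden : 0 < qA * Mval τA πA + qB * Mval τB πB + uA * Nval τA πA + uB * Nval τB πB) :
    (qA * Mval τA πA + qB * Mval τB πB) /
        (qA * Mval τA πA + qB * Mval τB πB + uA * Nval τA πA + uB * Nval τB πB) ≤
      (qA + qB) / ((qA + qB) + (uA + uB) * max (τA.2 / τA.1) (τB.2 / τB.1)) := by
  have hA0 : 0 < τA.1 := hτA.2.1.trans_lt hτA.1
  have hB0 : 0 < τB.1 := hτB.2.1.trans_lt hτB.1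
  have hA := div_mul_Mval_le_Nval hτA.1.le hA0 hπA.2.1
  have hB := div_mul_Mval_le_Nval hτB.1.le hB0 hπB.2.1
  rw [← hM, ← hN] at hB hden ⊢
  have hr0 : 0 ≤ max (τA.2 / τA.1) (τB.2 / τB.1) :=
    le_max_of_le_left (div_nonneg hτA.2.1 hA0.le)
  have hr : max (τA.2 / τA.1) (τB.2 / τB.1) * Mval τA πA ≤ Nval τA πA := by
    rcases max_choice (τA.2 / τA.1) (τB.2 / τB.1) with h | h <;> rwa [h]
  rw [div_le_div_iff₀ hden (by positivity)]
  have hqu : 0 ≤ (qA + qB) * (uA + uB) := by positivity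
  linarith [mul_le_mul_of_nonneg_left hr hqu]
end

section
/- Consider a k-stage screening process with minimally effective tests, and for each group X write r_X = ∏_{i=1}^k (τ^i_{X0}/τ^i_{X1}). Suppose max_{X∈𝒳} r_X > min_{X∈𝒳} r_X. Then every policy satisfying Equalized Odds (with positive precision denominator) has precision strictly less than ‖q‖₁ / (‖q‖₁ + Σ_{X∈𝒳} u_X r_X), which equals the maximum precision achievable by an Equal Opportunity policy (attained by the Opportunity Ratio policy). In particular, the optimal Equalized Odds precision is strictly smaller than the optimal Equal Opportunity precision. -/
open Finset

theorem Mval_nonneg_s14 {t p : ℝ × ℝ} (ht0 : 0 ≤ t.1) (ht1 : t.1 ≤ 1) (hp1 : 0 ≤ p.1)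
    (hp2 : 0 ≤ p.2) : 0 ≤ Mval t p :=
  add_nonneg (mul_nonneg ht0 hp1) (mul_nonneg (sub_nonneg.2 ht1) hp2)

theorem Mval_mul_ratio_le_Nval {t p : ℝ × ℝ} (ht : t.2 < t.1) (ht0 : 0 ≤ t.2) (hp : 0 ≤ p.2) :
    Mval t p * (t.2 / t.1) ≤ Nval t p := by
  have h1 : 0 < t.1 := ht0.trans_lt ht
  rw [← mul_div_assoc, div_le_iff₀ h1]
  unfold Mval Nval
  nlinarith [mul_nonneg hp (sub_nonneg.2 ht.le)]

section Pipeline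

variable {𝒳 : Type*} {k : ℕ} {τ π : 𝒳 → Fin k → ℝ × ℝ}

theorem MinEff.fst_pos (hτ : MinEff τ) (x : 𝒳) (i : Fin k) : 0 < (τ x i).1 :=
  (hτ x i).2.1.trans_lt (hτ x i).1

theorem MinEff.prod_ratio_nonneg (hτ : MinEff τ) (x : 𝒳) :
    0 ≤ ∏ i, (τ x i).2 / (τ x i).1 :=
  prod_nonneg fun i _ => div_nonneg (hτ x i).2.1 (hτ.fst_pos x i).le

theorem MX_nonneg (hτ : MinEff τ) (hπ : IsPolicy π) (x : 𝒳) : 0 ≤ MX τ π x :=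
  prod_nonneg fun i _ =>
    Mval_nonneg_s14 (hτ.fst_pos x i).le (hτ x i).2.2 (hπ x i).1.1 (hπ x i).2.1

theorem MX_mul_ratio_le_NX (hτ : MinEff τ) (hπ : IsPolicy π) (x : 𝒳) :
    MX τ π x * ∏ i, (τ x i).2 / (τ x i).1 ≤ NX τ π x := by
  unfold MX NX
  rw [← prod_mul_distrib]
  refine prod_le_prod (fun i _ => mul_nonneg ?_ ?_) fun i _ =>
    Mval_mul_ratio_le_Nval (hτ x i).1 (hτ x i).2.1 (hπ x i).2.1
  · exact Mval_nonneg_s14 (hτ.fst_pos x i).le (hτ x i).2.2 (hπ x i).1.1 (hπ x i).2.1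
  · exact div_nonneg (hτ x i).2.1 (hτ.fst_pos x i).le

/-- There is a policy with a common positive true positive rate `m` whose false positive rates
are the smallest ones compatible with `m`. -/
theorem exists_opportunityRatio [Fintype 𝒳] (hτ : MinEff τ) :
    ∃ π : 𝒳 → Fin k → ℝ × ℝ, IsPolicy π ∧ ∃ m : ℝ, 0 < m ∧ (∀ x, MX τ π x = m) ∧
      ∀ x, NX τ π x = m * ∏ i, (τ x i).2 / (τ x i).1 := by
  have hd : ∀ i, 0 < ∏ y, (τ y i).1 := fun i => prod_pos fun y _ => hτ.fst_pos y i
  refine ⟨fun x i => ((∏ y, (τ y i).1) / (τ x i).1, 0), fun x i => ⟨⟨?_, ?_⟩, ?_⟩,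
    ∏ i, ∏ y, (τ y i).1, prod_pos fun i _ => hd i, fun x => ?_, fun x => ?_⟩
  · exact div_nonneg (hd i).le (hτ.fst_pos x i).le
  · refine div_le_one_of_le₀ ?_ (hτ.fst_pos x i).le
    classical
    rw [← mul_prod_erase univ _ (mem_univ x)]
    exact mul_le_of_le_one_right (hτ.fst_pos x i).le
      (prod_le_one (fun y _ => (hτ.fst_pos y i).le) fun y _ => (hτ y i).2.2)
  · simp
  · refine prod_congr rfl fun i _ => ?_
    have := (hτ.fst_pos x i).ne'
    simp only [Mval]
    field_simp
    ring
  · unfold NX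
    rw [← prod_mul_distrib]
    refine prod_congr rfl fun i _ => ?_
    simp only [Nval]
    ring

theorem prec_eq_of_MX_eq [Fintype 𝒳] {q u : 𝒳 → ℝ} {m : ℝ} (hM : ∀ x, MX τ π x = m) :
    prec q u τ π = (m * ∑ x, q x) / ((m * ∑ x, q x) + ∑ x, u x * NX τ π x) := by
  simp only [prec, hM, ← sum_mul, mul_comm m]

end Pipeline

/-- If `max_X ∏_i (τ^i_{X0}/τ^i_{X1}) > min_X ∏_i (τ^i_{X0}/τ^i_{X1})`, then every Equalized
Odds policy has precision strictly below `‖q‖₁/(‖q‖₁ + Σ_X u_X ∏_i (τ^i_{X0}/τ^i_{X1}))`,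
which is the maximum precision attainable by Equal Opportunity policies (attained by some
Equal Opportunity policy). -/
theorem stmt14 {𝒳 : Type*} [Fintype 𝒳] [Nonempty 𝒳] {k : ℕ}
    (q u : 𝒳 → ℝ) (τ : 𝒳 → Fin k → ℝ × ℝ)
    (hq : ∀ x, 0 < q x) (hu : ∀ x, 0 < u x) (hτ : MinEff τ)
    (hgap : ∃ x y, (∏ i, (τ x i).2 / (τ x i).1) < ∏ i, (τ y i).2 / (τ y i).1) :
    (∀ π : 𝒳 → Fin k → ℝ × ℝ, IsPolicy π →
      (∀ x y, MX τ π x = MX τ π y) → (∀ x y, NX τ π x = NX τ π y) →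
      0 < (∑ x, q x * MX τ π x) + ∑ x, u x * NX τ π x →
      prec q u τ π <
        (∑ x, q x) / ((∑ x, q x) + ∑ x, u x * ∏ i, (τ x i).2 / (τ x i).1)) ∧
    ∃ πOR : 𝒳 → Fin k → ℝ × ℝ, IsPolicy πOR ∧ (∀ x y, MX τ πOR x = MX τ πOR y) ∧
      (0 < (∑ x, q x * MX τ πOR x) + ∑ x, u x * NX τ πOR x) ∧
      (prec q u τ πOR =
        (∑ x, q x) / ((∑ x, q x) + ∑ x, u x * ∏ i, (τ x i).2 / (τ x i).1)) ∧
      ∀ π : 𝒳 → Fin k → ℝ × ℝ, IsPolicy π → (∀ x y, MX τ π x = MX τ π y) →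
        0 < (∑ x, q x * MX τ π x) + ∑ x, u x * NX τ π x →
        prec q u τ π ≤ prec q u τ πOR := by
  have hQ : 0 < ∑ x, q x := sum_pos (fun x _ => hq x) univ_nonempty
  have hR : 0 ≤ ∑ x, u x * ∏ i, (τ x i).2 / (τ x i).1 :=
    sum_nonneg fun x _ => mul_nonneg (hu x).le (hτ.prod_ratio_nonneg x)
  set R := ∑ x, u x * ∏ i, (τ x i).2 / (τ x i).1 with hRdef
  have hmR : ∀ m : ℝ, m * R = ∑ x, u x * (m * ∏ i, (τ x i).2 / (τ x i).1) := fun m => by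
    rw [hRdef, mul_sum]
    exact sum_congr rfl fun x _ => by ring
  obtain ⟨x₀⟩ := ‹Nonempty 𝒳›
  have hden : ∀ {π : 𝒳 → Fin k → ℝ × ℝ} {m : ℝ}, (∀ x, MX τ π x = m) →
      (∑ x, q x * MX τ π x) = m * ∑ x, q x := fun hM => by
    rw [mul_comm, sum_mul]
    simp only [hM]
  refine ⟨fun π hπ hM hN hpos => ?_, ?_⟩
  · have hM' : ∀ x, MX τ π x = MX τ π x₀ := fun x => hM x x₀
    have hm := MX_nonneg hτ hπ x₀
    rw [hden hM'] at hpos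
    rw [prec_eq_of_MX_eq hM', div_lt_div_iff₀ hpos (by linarith)]
    have key : MX τ π x₀ * R < ∑ x, u x * NX τ π x := by
      rcases hm.eq_or_lt with h0 | h0
      · rw [← h0] at hpos ⊢
        linarith
      · obtain ⟨a, b, hab⟩ := hgap
        rw [hmR]
        refine sum_lt_sum (fun x _ => mul_le_mul_of_nonneg_left ?_ (hu x).le)
          ⟨a, mem_univ a, mul_lt_mul_of_pos_left ?_ (hu a)⟩
        · exact hM' x ▸ MX_mul_ratio_le_NX hτ hπ x
        · rw [hN a b]
          exact (mul_lt_mul_of_pos_left hab h0).trans_le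
            (hM' b ▸ MX_mul_ratio_le_NX hτ hπ b)
    nlinarith [mul_lt_mul_of_pos_left key hQ]
  · obtain ⟨πOR, hπOR, m, hm, hM, hN⟩ := exists_opportunityRatio hτ
    have hNsum : ∑ x, u x * NX τ πOR x = m * R := by simp only [hmR, hN]
    have hprec : prec q u τ πOR = (∑ x, q x) / ((∑ x, q x) + R) := by
      rw [prec_eq_of_MX_eq hM, hNsum, ← mul_add, mul_div_mul_left _ _ hm.ne']
    refine ⟨πOR, hπOR, fun x y => (hM x).trans (hM y).symm, ?_, hprec,
      fun π hπ hM hpos => ?_⟩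
    · rw [hden hM, hNsum]
      positivity
    · have hM' : ∀ x, MX τ π x = MX τ π x₀ := fun x => hM x x₀
      rw [hden hM'] at hpos
      rw [hprec, prec_eq_of_MX_eq hM', div_le_div_iff₀ hpos (by linarith)]
      have key : MX τ π x₀ * R ≤ ∑ x, u x * NX τ π x := by
        rw [hmR]
        exact sum_le_sum fun x _ => mul_le_mul_of_nonneg_left
          (hM' x ▸ MX_mul_ratio_le_NX hτ hπ x) (hu x).le
      nlinarith [mul_le_mul_of_nonneg_left key hQ.le]
end
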